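/- Let f be a computable function of two string arguments. There exist constants d and d' (depending only on f and the universal machine) such that: for every ε ∈ [0,1] and every protocol with error Π = (𝓡, t, g_A, g_B) over D = {0,1}^{n₁} × {0,1}^{n₂} that computes f with error ε, the set of pairs (x,y) ∈ D satisfying C(t_{x,y} ∣ Π) ≥ C(f_{x,y} ∣ x, Π) + C(f_{x,y} ∣ y, Π) + C(t_{x,y} ∣ x, f_{x,y}, Π) + C(t_{x,y} ∣ y, f_{x,y}, Π) − log₂ ρ(t_{x,y}) − d·log₂ n − d has cardinality at least (1 − d'·ε)·|D|, where n = max(n₁, n₂) and f_{x,y} = f(x,y). -/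

import Mathlib

/-- A machine maps a program and a condition string to at most one output string. -/
abbrev Machine := List Bool → List Bool →. List Bool

/-- Conditional Kolmogorov complexity relative to machine `U`. -/
noncomputable def KC (U : Machine) (x u : List Bool) : ℕ :=
  sInf { k | ∃ p : List Bool, p.length = k ∧ x ∈ U p u }

/-- `U` is a universal machine. -/
def IsUniversal (U : Machine) : Prop :=
  Partrec₂ U ∧
    ∀ V : Machine, Partrec₂ V →
      ∃ c : ℕ, ∀ p u x, x ∈ V p u → ∃ q : List Bool, x ∈ U q u ∧ q.length ≤ p.length + c

/-- Self-delimiting encoding of a string. -/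
def eBits (x : List Bool) : List Bool := (x.map fun b => [b, b]).flatten ++ [true, false]

/-- The fixed computable pairing of strings. -/
def ePair (x y : List Bool) : List Bool := eBits x ++ y

/-- Encoding of a list of strings. -/
def eList (l : List (List Bool)) : List Bool := (l.map eBits).flatten

/-- Conditional mutual information `I(x : y ∣ u)`. -/
noncomputable def MI (U : Machine) (x y u : List Bool) : ℝ :=
  (KC U x u : ℝ) + KC U y u - KC U (ePair x y) u

/-- Conditional triple information `I(x : y : w ∣ u)`. -/
noncomputable def TI (U : Machine) (x y w u : List Bool) : ℝ :=
  (KC U x u : ℝ) + KC U y u + KC U w u - KC U (ePair x y) u - KC U (ePair x w) u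
    - KC U (ePair y w) u + KC U (ePair x (ePair y w)) u

/-- A combinatorial rectangle, given by its list of rows and list of columns. -/
structure Rect where
  rows : List (List Bool)
  cols : List (List Bool)
deriving DecidableEq

/-- Canonical encoding of a rectangle. -/
def encRect (R : Rect) : List Bool := ePair (eList R.rows) (eList R.cols)

/-- The list of all bit strings of length `n`. -/
def allBV : ℕ → List (List Bool)
  | 0 => [[]]
  | n + 1 => (allBV n).flatMap fun x => [false :: x, true :: x]

/-- A nondeterministic communication protocol over `{0,1}^{n₁} × {0,1}^{n₂}`:
a finite family of rectangles covering the domain together with a transcript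
function selecting, for every cell of the domain, a rectangle containing it. -/
structure Protocol (n₁ n₂ : ℕ) where
  rects : List Rect
  trans : List Bool → List Bool → Rect
  rows_len : ∀ R ∈ rects, ∀ s ∈ R.rows, s.length = n₁
  cols_len : ∀ R ∈ rects, ∀ s ∈ R.cols, s.length = n₂
  trans_mem : ∀ x y : List Bool, x.length = n₁ → y.length = n₂ → trans x y ∈ rects
  trans_row : ∀ x y : List Bool, x.length = n₁ → y.length = n₂ → x ∈ (trans x y).rows
  trans_col : ∀ x y : List Bool, x.length = n₁ → y.length = n₂ → y ∈ (trans x y).cols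

/-- The thickness of a cell: the number of rectangles of the protocol containing it. -/
def cellThick {n₁ n₂ : ℕ} (P : Protocol n₁ n₂) (x y : List Bool) : ℕ :=
  P.rects.countP fun R => decide (x ∈ R.rows ∧ y ∈ R.cols)

/-- The thickness of a rectangle: the maximal thickness of a cell of the rectangle. -/
def rectThick {n₁ n₂ : ℕ} (P : Protocol n₁ n₂) (R : Rect) : ℕ :=
  (R.rows.flatMap fun x => R.cols.map fun y => cellThick P x y).foldr max 0

/-- Canonical encoding of a protocol: the list of its rectangles followed by
the graph of the transcript function on the domain. -/
def encProt {n₁ n₂ : ℕ} (P : Protocol n₁ n₂) : List Bool :=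
  ePair (eList (P.rects.map encRect))
    (eList ((allBV n₁).flatMap fun x => (allBV n₂).map fun y => encRect (P.trans x y)))

/-- A protocol with error: a protocol together with output functions of Alice and Bob. -/
structure EProtocol (n₁ n₂ : ℕ) extends Protocol n₁ n₂ where
  gA : List Bool → Rect → List Bool
  gB : List Bool → Rect → List Bool

/-- Canonical encoding of a protocol with error. -/
def encEProt {n₁ n₂ : ℕ} (P : EProtocol n₁ n₂) : List Bool :=
  ePair (encProt P.toProtocol)
    (ePair (eList ((allBV n₁).flatMap fun x => P.rects.map fun R => P.gA x R))
           (eList ((allBV n₂).flatMap fun y => P.rects.map fun R => P.gB y R)))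


namespace TranscriptBound

open Finset

attribute [fun_prop] Primrec
attribute [fun_prop] Primrec.id Primrec.const Primrec.fst Primrec.snd

section Primrec

variable {α β γ : Type} [Primcodable α] [Primcodable β] [Primcodable γ]

@[fun_prop]
theorem primrec_comp {f : β → γ} {g : α → β} (hf : Primrec f) (hg : Primrec g) :
    Primrec fun a => f (g a) := hf.comp hg

@[fun_prop]
theorem primrec_prodMk {f : α → β} {g : α → γ} (hf : Primrec f) (hg : Primrec g) :
    Primrec fun a => (f a, g a) := hf.pair hg

@[fun_prop]
theorem primrec_append {f g : α → List β} (hf : Primrec f) (hg : Primrec g) :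
    Primrec fun a => f a ++ g a := Primrec.list_append.comp hf hg

@[fun_prop]
theorem primrec_cons {f : α → β} {g : α → List β} (hf : Primrec f) (hg : Primrec g) :
    Primrec fun a => f a :: g a := Primrec.list_cons.comp hf hg

@[fun_prop]
theorem primrec_length {f : α → List β} (hf : Primrec f) :
    Primrec fun a => (f a).length := Primrec.list_length.comp hf

@[fun_prop]
theorem primrec_map {f : α → List β} {g : β → γ} (hf : Primrec f) (hg : Primrec g) :
    Primrec fun a => (f a).map g := Primrec.list_map hf (hg.comp₂ Primrec₂.right)

@[fun_prop]
theorem primrec_flatten {f : α → List (List β)} (hf : Primrec f) :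
    Primrec fun a => (f a).flatten := Primrec.list_flatten.comp hf

@[fun_prop]
theorem primrec_getElem? {f : α → List β} {g : α → ℕ} (hf : Primrec f) (hg : Primrec g) :
    Primrec fun a => (f a)[g a]? := Primrec.list_getElem?.comp hf hg

@[fun_prop]
theorem primrec_some {f : α → β} (hf : Primrec f) : Primrec fun a => some (f a) :=
  Primrec.option_some.comp hf

@[fun_prop]
theorem primrec_add {f g : α → ℕ} (hf : Primrec f) (hg : Primrec g) :
    Primrec fun a => f a + g a := Primrec.nat_add.comp hf hg

@[fun_prop]
theorem primrec_mul {f g : α → ℕ} (hf : Primrec f) (hg : Primrec g) :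
    Primrec fun a => f a * g a := Primrec.nat_mul.comp hf hg

@[fun_prop]
theorem primrec_two_pow {f : α → ℕ} (hf : Primrec f) : Primrec fun a => 2 ^ f a :=
  (Primrec.nat_rec₁ (f := fun _ r => 2 * r) 1
    (Primrec.nat_mul.comp₂ (Primrec₂.const 2) Primrec₂.right)).comp hf |>.of_eq fun a => by
      induction f a with
      | zero => rfl
      | succ n ih => simp_all [pow_succ, mul_comm]

@[fun_prop]
theorem primrec_encode {f : α → β} (hf : Primrec f) : Primrec fun a => Encodable.encode (f a) :=
  Primrec.encode.comp hf

@[fun_prop]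
theorem primrec_decode {f : α → ℕ} (hf : Primrec f) :
    Primrec fun a => (Encodable.decode (f a) : Option β) :=
  Primrec.decode.comp hf

@[fun_prop]
theorem primrec_unpair {f : α → ℕ} (hf : Primrec f) : Primrec fun a => (f a).unpair :=
  Primrec.unpair.comp hf

@[fun_prop]
theorem primrec_and {f g : α → Bool} (hf : Primrec f) (hg : Primrec g) :
    Primrec fun a => f a && g a := Primrec.and.comp hf hg

theorem primrecPred_eq {f g : α → β} (hf : Primrec f) (hg : Primrec g) :
    PrimrecPred fun a => f a = g a := Primrec.eq.comp hf hg

theorem primrecPred_le {f g : α → ℕ} (hf : Primrec f) (hg : Primrec g) :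
    PrimrecPred fun a => f a ≤ g a := Primrec.nat_le.comp hf hg

theorem primrecPred_mem {f : α → β} {g : α → List β} (hf : Primrec f) (hg : Primrec g) :
    PrimrecPred fun a => f a ∈ g a :=
  ((Primrec.eq (α := β)).exists_mem_list.comp hg hf).of_eq fun a => by simp

theorem primrecPred_forall_mem {g : α → List β} {p : α → β → Prop} (hg : Primrec g)
    (hp : PrimrecPred fun q : α × β => p q.1 q.2) :
    PrimrecPred fun a => ∀ b ∈ g a, p a b :=
  PrimrecRel.comp (PrimrecRel.forall_mem_list (R := fun b a => p a b)
    (hp.comp (Primrec.snd.pair Primrec.fst))) hg Primrec.id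

theorem primrecPred_nodup : PrimrecPred fun l : List α => l.Nodup := by
  classical
  have h : Primrec fun l : List α =>
      (List.rec true (fun b l ih => decide (b ∉ l) && ih) l : Bool) :=
    Primrec.list_rec Primrec.id (Primrec.const true)
      (h := fun _ q => decide (q.1 ∉ q.2.1) && q.2.2) <| by
      have : Primrec fun q : List α × α × List α × Bool => decide (q.2.1 ∉ q.2.2.1) :=
        (primrecPred_mem (by fun_prop) (by fun_prop)).not.decide
      exact Primrec.and.comp this (by fun_prop)
  refine (primrecPred_eq h (Primrec.const true)).of_eq fun l => ?_
  induction l with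
  | nil => simp
  | cons b l ih => simp_all

end Primrec

/-- Recursively enumerable predicates, presented as projections of primitive recursive ones. -/
def SigmaOne {α : Type} [Primcodable α] (R : α → Prop) : Prop :=
  ∃ g : α × ℕ → Bool, Primrec g ∧ ∀ a, R a ↔ ∃ w, g (a, w) = true

namespace SigmaOne

variable {α β : Type} [Primcodable α] [Primcodable β]

theorem of_primrecPred {R : α → Prop} (h : PrimrecPred R) : SigmaOne R := by
  obtain ⟨_, h⟩ := h
  exact ⟨fun a => decide (R a.1), h.comp Primrec.fst, by simp⟩

theorem of_iff {R S : α → Prop} (h : SigmaOne R) (e : ∀ a, S a ↔ R a) : SigmaOne S := by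
  obtain ⟨g, hg, hR⟩ := h
  exact ⟨g, hg, fun a => (e a).trans (hR a)⟩

theorem comp {R : β → Prop} {f : α → β} (h : SigmaOne R) (hf : Primrec f) :
    SigmaOne fun a => R (f a) := by
  obtain ⟨g, hg, hR⟩ := h
  exact ⟨fun a => g (f a.1, a.2), by fun_prop, fun a => hR _⟩

theorem and {R S : α → Prop} (hR : SigmaOne R) (hS : SigmaOne S) :
    SigmaOne fun a => R a ∧ S a := by
  obtain ⟨g, hg, hR⟩ := hR
  obtain ⟨k, hk, hS⟩ := hS
  refine ⟨fun a => g (a.1, a.2.unpair.1) && k (a.1, a.2.unpair.2), by fun_prop, fun a => ?_⟩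
  refine (and_congr (hR a) (hS a)).trans ?_
  constructor
  · rintro ⟨⟨w, hw⟩, w', hw'⟩
    exact ⟨Nat.pair w w', by simp [hw, hw']⟩
  · rintro ⟨w, hw⟩
    simp only [Bool.and_eq_true] at hw
    exact ⟨⟨_, hw.1⟩, _, hw.2⟩

theorem ex {R : α → β → Prop} (h : SigmaOne fun q : α × β => R q.1 q.2) :
    SigmaOne fun a => ∃ b, R a b := by
  obtain ⟨g, hg, hR⟩ := h
  refine ⟨fun q => Option.casesOn (Encodable.decode q.2.unpair.1 : Option β) false
    fun b => g ((q.1, b), q.2.unpair.2), ?_, fun a => ?_⟩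
  · have hk : Primrec fun q : (α × ℕ) × β => g ((q.1.1, q.2), q.1.2.unpair.2) := by fun_prop
    exact Primrec.option_casesOn (by fun_prop) (by fun_prop) hk.to₂
  constructor
  · rintro ⟨b, hb⟩
    obtain ⟨w, hw⟩ := (hR (a, b)).1 hb
    exact ⟨Nat.pair (Encodable.encode b) w, by simp [hw]⟩
  · rintro ⟨w, hw⟩
    dsimp only at hw
    cases hd : (Encodable.decode w.unpair.1 : Option β) with
    | none => simp [hd] at hw
    | some b => exact ⟨b, (hR (a, b)).2 ⟨_, by simpa [hd] using hw⟩⟩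

theorem exists_finset {R : α → β → Prop} {N : α → ℕ}
    (h : SigmaOne fun q : α × β => R q.1 q.2) (hN : Primrec N) :
    SigmaOne fun a => ∃ s : Finset β, N a ≤ s.card ∧ ∀ b ∈ s, R a b := by
  classical
  obtain ⟨g, hg, hR⟩ := h
  have key : SigmaOne fun a => ∃ l : List (β × ℕ), N a ≤ l.length ∧ (l.map Prod.fst).Nodup ∧
      ∀ q ∈ l, g ((a, q.1), q.2) = true := by
    refine ex (of_primrecPred ?_)
    refine (primrecPred_le (by fun_prop) (by fun_prop)).and
      ((primrecPred_nodup.comp (by fun_prop)).and ?_)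
    exact primrecPred_forall_mem (by fun_prop) (primrecPred_eq (by fun_prop) (by fun_prop))
  refine key.of_iff fun a => ?_
  constructor
  · rintro ⟨s, hs, hR'⟩
    choose! w hw using fun b (hb : b ∈ s) => (hR (a, b)).1 (hR' b hb)
    refine ⟨s.toList.map fun b => (b, w b), by simpa using hs, ?_, ?_⟩
    · simpa [List.map_map, Function.comp_def] using s.nodup_toList
    · simp only [List.mem_map, Finset.mem_toList]
      rintro _ ⟨b, hb, rfl⟩
      exact hw b hb
  · rintro ⟨l, hl, hn, hg'⟩
    refine ⟨(l.map Prod.fst).toFinset, ?_, ?_⟩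
    · rwa [List.toFinset_card_of_nodup hn, List.length_map]
    · simp only [List.mem_toFinset, List.mem_map]
      rintro _ ⟨q, hq, rfl⟩
      exact (hR (a, q.1)).2 ⟨_, hg' q hq⟩

end SigmaOne

section Encoding

theorem eBits_nil : eBits [] = [true, false] := rfl

theorem eBits_cons (b : Bool) (x : List Bool) : eBits (b :: x) = b :: b :: eBits x := rfl

theorem eBits_length (x : List Bool) : (eBits x).length = 2 * x.length + 2 := by
  induction x with
  | nil => rfl
  | cons b x ih => simp only [eBits_cons, List.length_cons, ih]; ring

theorem eBits_append_inj {x x' y y' : List Bool} (h : eBits x ++ y = eBits x' ++ y') :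
    x = x' ∧ y = y' := by
  induction x generalizing x' with
  | nil => cases x' with
    | nil => simpa [eBits_nil] using h
    | cons b x' => cases b <;> simp [eBits_nil, eBits_cons] at h
  | cons b x ih => cases x' with
    | nil => cases b <;> simp [eBits_nil, eBits_cons] at h
    | cons b' x' =>
      simp only [eBits_cons, List.cons_append, List.cons.injEq] at h
      obtain ⟨rfl, rfl⟩ := ih h.2.2
      exact ⟨by rw [h.1], rfl⟩

theorem ePair_inj {x x' y y' : List Bool} : ePair x y = ePair x' y' ↔ x = x' ∧ y = y' :=
  ⟨eBits_append_inj, by rintro ⟨rfl, rfl⟩; rfl⟩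

theorem eList_injective : Function.Injective eList := by
  intro l l' h
  induction l generalizing l' with
  | nil => cases l' with
    | nil => rfl
    | cons x l' => simp [eList, eBits] at h
  | cons x l ih => cases l' with
    | nil => simp [eList, eBits] at h
    | cons x' l' =>
      obtain ⟨rfl, h'⟩ := eBits_append_inj (y := eList l) (y' := eList l')
        (by simpa [eList] using h)
      rw [ih h']

theorem encRect_injective : Function.Injective encRect := by
  rintro ⟨r, c⟩ ⟨r', c'⟩ h
  obtain ⟨hr, hc⟩ := ePair_inj.1 h
  exact Rect.mk.injEq .. ▸ ⟨eList_injective hr, eList_injective hc⟩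

variable {α : Type} [Primcodable α]

@[fun_prop]
theorem primrec_eBits {f : α → List Bool} (hf : Primrec f) : Primrec fun a => eBits (f a) := by
  unfold eBits
  fun_prop

@[fun_prop]
theorem primrec_ePair {f g : α → List Bool} (hf : Primrec f) (hg : Primrec g) :
    Primrec fun a => ePair (f a) (g a) := by
  unfold ePair
  fun_prop

@[fun_prop]
theorem primrec_eList {f : α → List (List Bool)} (hf : Primrec f) :
    Primrec fun a => eList (f a) := by
  unfold eList
  have : Primrec eBits := primrec_eBits Primrec.id
  fun_prop

/-- The value of a bit string read in binary, least significant bit first. -/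
def bitsVal (l : List Bool) : ℕ := l.foldr (fun b n => n * 2 + bif b then 1 else 0) 0

theorem bitsVal_cons (b : Bool) (l : List Bool) :
    bitsVal (b :: l) = bitsVal l * 2 + bif b then 1 else 0 := rfl

@[fun_prop]
theorem primrec_bitsVal {f : α → List Bool} (hf : Primrec f) : Primrec fun a => bitsVal (f a) := by
  have hc : Primrec fun q : List Bool × Bool × ℕ => bif q.2.1 then 1 else 0 :=
    Primrec.cond (by fun_prop) (by fun_prop) (by fun_prop)
  have h : Primrec fun q : List Bool × Bool × ℕ => q.2.2 * 2 + bif q.2.1 then 1 else 0 := by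
    fun_prop
  exact (Primrec.list_foldr Primrec.id (Primrec.const 0) h.to₂).comp hf

theorem exists_bitsVal_eq {m i : ℕ} (h : i < 2 ^ m) : ∃ l, l.length = m ∧ bitsVal l = i := by
  induction m generalizing i with
  | zero => exact ⟨[], rfl, by simp at h; simp [bitsVal, h]⟩
  | succ m ih =>
    obtain ⟨l, hl, hv⟩ := ih (i := i / 2) (by rw [pow_succ] at h; omega)
    refine ⟨decide (i % 2 = 1) :: l, by simp [hl], ?_⟩
    rw [bitsVal_cons, hv]
    rcases Nat.mod_two_eq_zero_or_one i with h | h <;> simp [h] <;> omega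

theorem getElem?_flatMap_of_length {α β : Type} {l : List α} {f : α → List β} {k : ℕ}
    (hk : ∀ a ∈ l, (f a).length = k) {j i : ℕ} {a : α} {b : β} (ha : l[j]? = some a)
    (hb : (f a)[i]? = some b) : (l.flatMap f)[j * k + i]? = some b := by
  induction l generalizing j with
  | nil => simp at ha
  | cons c l ih =>
    have hc := hk c (by simp)
    rw [List.flatMap_cons]
    cases j with
    | zero =>
      obtain rfl : c = a := by simpa using ha
      have : i < (f c).length := by
        by_contra h
        rw [List.getElem?_eq_none (by omega)] at hb
        cases hb
      rwa [zero_mul, zero_add, List.getElem?_append_left this]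
    | succ j =>
      rw [List.getElem?_append_right (by rw [hc, add_mul]; omega), hc,
        show (j + 1) * k + i - k = j * k + i by rw [add_mul]; omega]
      exact ih (fun a h => hk a (by simp [h])) (by simpa using ha)

theorem allBV_length (n : ℕ) : (allBV n).length = 2 ^ n := by
  induction n with
  | zero => rfl
  | succ n ih => simp [allBV, List.length_flatMap, ih, pow_succ]

theorem getElem?_allBV {n : ℕ} {x : List Bool} (hx : x.length = n) :
    (allBV n)[bitsVal x]? = some x := by
  induction x generalizing n with
  | nil => subst hx; rfl
  | cons b x ih =>
    subst hx
    exact getElem?_flatMap_of_length (by simp) (ih rfl) (by cases b <;> rfl)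

end Encoding

section Enumeration

/-- A recursively enumerable relation is computed by a machine wherever it is functional. -/
theorem exists_machine {G : List Bool → List Bool → List Bool → Prop}
    (hG : SigmaOne fun a : List Bool × List Bool × List Bool => G a.1 a.2.1 a.2.2) :
    ∃ V : Machine, Partrec₂ V ∧
      ∀ p u z, G p u z → (∀ z', G p u z' → z' = z) → z ∈ V p u := by
  obtain ⟨g, hg, hR⟩ := hG
  let F : List Bool × List Bool → ℕ → Option (List Bool) := fun q n =>
    Option.casesOn (Encodable.decode n : Option (List Bool × ℕ)) none fun b =>
      bif g ((q.1, q.2, b.1), b.2) then some b.1 else none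
  have hF : Primrec₂ F := by
    have hk : Primrec fun q : ((List Bool × List Bool) × ℕ) × (List Bool × ℕ) =>
        bif g ((q.1.1.1, q.1.1.2, q.2.1), q.2.2) then some q.2.1 else none :=
      Primrec.cond (by fun_prop) (by fun_prop) (by fun_prop)
    exact Primrec.option_casesOn (by fun_prop) (by fun_prop) hk.to₂
  have hF_sound : ∀ p u n z, z ∈ F (p, u) n → G p u z := by
    intro p u n z h
    simp only [F] at h
    cases hd : (Encodable.decode n : Option (List Bool × ℕ)) with
    | none => simp [hd] at h
    | some b =>
      rw [hd] at h
      dsimp only at h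
      cases hb : g ((p, u, b.1), b.2) with
      | false => simp [hb] at h
      | true =>
        obtain rfl : b.1 = z := by simpa [hb] using h
        exact (hR (p, u, b.1)).2 ⟨_, hb⟩
  refine ⟨fun p u => Nat.rfindOpt (F (p, u)), Partrec.rfindOpt hF.to_comp, fun p u z hz hu => ?_⟩
  obtain ⟨w, hw⟩ := (hR (p, u, z)).1 hz
  have hd : (Nat.rfindOpt (F (p, u))).Dom :=
    Nat.rfindOpt_dom.2 ⟨Encodable.encode (z, w), z, by simp only [F, Encodable.encodek]; simp [hw]⟩
  obtain ⟨z', hz'⟩ := Part.dom_iff_mem.1 hd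
  obtain ⟨n, hn⟩ := Nat.rfindOpt_spec hz'
  rwa [hu z' (hF_sound _ _ _ _ hn)] at hz'

variable {α β : Type} [Primcodable β]

open Classical in
/-- One step of the enumeration of the elements accepted by `g`. -/
noncomputable def enumStep (g : (α × β) × ℕ → Bool) (a : α) (n : ℕ) (l : List β) : List β :=
  Option.casesOn (Encodable.decode n : Option (β × ℕ)) l fun b =>
    if g ((a, b.1), b.2) = true ∧ b.1 ∉ l then b.1 :: l else l

/-- The distinct elements enumerated by `g` within `N` steps, the most recent one first. -/
noncomputable def enumList (g : (α × β) × ℕ → Bool) (a : α) (N : ℕ) : List β :=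
  Nat.rec [] (enumStep g a) N

variable {g : (α × β) × ℕ → Bool}

theorem enumStep_eq (g : (α × β) × ℕ → Bool) (a : α) (n : ℕ) (l : List β) :
    enumStep g a n l = l ∨
      ∃ b w, enumStep g a n l = b :: l ∧ g ((a, b), w) = true ∧ b ∉ l := by
  unfold enumStep
  cases (Encodable.decode n : Option (β × ℕ)) with
  | none => exact Or.inl rfl
  | some b =>
    by_cases h : g ((a, b.1), b.2) = true ∧ b.1 ∉ l
    · exact Or.inr ⟨b.1, b.2, if_pos h, h.1, h.2⟩
    · exact Or.inl (if_neg h)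

theorem enumList_succ (g : (α × β) × ℕ → Bool) (a : α) (N : ℕ) :
    enumList g a (N + 1) = enumList g a N ∨
      ∃ b w, enumList g a (N + 1) = b :: enumList g a N ∧ g ((a, b), w) = true ∧
        b ∉ enumList g a N :=
  enumStep_eq g a N _

theorem mem_enumList_encode {a : α} {b : β} {w : ℕ} (h : g ((a, b), w) = true) :
    b ∈ enumList g a (Encodable.encode (b, w) + 1) := by
  change b ∈ enumStep g a (Encodable.encode (b, w)) _
  unfold enumStep
  rw [Encodable.encodek]
  dsimp only
  split_ifs with hb
  · exact List.mem_cons_self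
  · simpa [h] using hb

theorem enumList_spec (a : α) (N : ℕ) :
    (enumList g a N).Nodup ∧ ∀ b ∈ enumList g a N, ∃ w, g ((a, b), w) = true := by
  induction N with
  | zero => exact ⟨List.nodup_nil, by simp [enumList]⟩
  | succ N ih =>
    rcases enumList_succ g a N with h | ⟨b, w, h, hw, hb⟩
    · rwa [h]
    · rw [h]
      refine ⟨List.nodup_cons.2 ⟨hb, ih.1⟩, fun c hc => ?_⟩
      rcases List.mem_cons.1 hc with rfl | hc
      exacts [⟨w, hw⟩, ih.2 c hc]

theorem enumList_length_mono (a : α) : Monotone fun N => (enumList g a N).length := by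
  refine monotone_nat_of_le_succ fun N => ?_
  rcases enumList_succ g a N with h | ⟨b, w, h, -⟩ <;> simp [h]

theorem exists_enumList_succ_eq_cons {a : α} {b : β} {w : ℕ} (h : g ((a, b), w) = true) :
    ∃ N, enumList g a (N + 1) = b :: enumList g a N := by
  have key : ∀ N, b ∈ enumList g a N → ∃ N, enumList g a (N + 1) = b :: enumList g a N := by
    intro N
    induction N with
    | zero => simp [enumList]
    | succ N ih =>
      intro hb
      rcases enumList_succ g a N with h | ⟨c, w, h, -⟩
      · exact ih (h ▸ hb)
      · rw [h] at hb
        rcases List.mem_cons.1 hb with rfl | hb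
        exacts [⟨N, h⟩, ih hb]
  exact key _ (mem_enumList_encode h)

theorem enumList_cons_unique {a : α} {b b' : β} {N N' : ℕ}
    (h : enumList g a (N + 1) = b :: enumList g a N)
    (h' : enumList g a (N' + 1) = b' :: enumList g a N')
    (hl : (enumList g a N).length = (enumList g a N').length) : b = b' := by
  have hN : ∀ {M M' : ℕ} {c c' : β}, enumList g a (M + 1) = c :: enumList g a M →
      enumList g a (M' + 1) = c' :: enumList g a M' →
      (enumList g a M).length = (enumList g a M').length → ¬ M < M' := by
    intro M M' c c' hM _ hl hlt
    have := enumList_length_mono (g := g) a (Nat.succ_le_of_lt hlt)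
    simp only [Nat.succ_eq_add_one, hM, List.length_cons] at this
    omega
  obtain rfl : N = N' :=
    le_antisymm (not_lt.1 (hN h' h hl.symm)) (not_lt.1 (hN h h' hl))
  rw [h] at h'
  exact (List.cons.inj h').1

@[fun_prop]
theorem primrec_enumList [Primcodable α] (hg : Primrec g) {γ : Type} [Primcodable γ] {f : γ → α}
    {N : γ → ℕ} (hf : Primrec f) (hN : Primrec N) : Primrec fun c => enumList g (f c) (N c) := by
  classical
  have hk : Primrec fun q : (α × ℕ × List β) × (β × ℕ) =>
      if g ((q.1.1, q.2.1), q.2.2) = true ∧ q.2.1 ∉ q.1.2.2 then q.2.1 :: q.1.2.2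
        else q.1.2.2 :=
    Primrec.ite ((primrecPred_eq (by fun_prop) (by fun_prop)).and
      (primrecPred_mem (by fun_prop) (by fun_prop)).not) (by fun_prop) (by fun_prop)
  have hs : Primrec fun q : α × ℕ × List β => enumStep g q.1 q.2.1 q.2.2 :=
    (Primrec.option_casesOn (o := fun q => (Encodable.decode q.2.1 : Option (β × ℕ)))
      (f := fun q => q.2.2) (by fun_prop) (by fun_prop) hk.to₂).of_eq fun q => by
      unfold enumStep
      congr!
  have h : Primrec₂ fun a N => enumList g a N :=
    Primrec.nat_rec (Primrec.const []) hs.to₂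
  exact h.comp hf hN

end Enumeration

section Complexity

variable {U : Machine}

/-- `z` has a description of length at most `k` given `v`. -/
def DescLe (U : Machine) (k : ℕ) (z v : List Bool) : Prop := ∃ p, p.length ≤ k ∧ z ∈ U p v

theorem DescLe.mono {k k' : ℕ} {z v : List Bool} (h : DescLe U k z v) (hk : k ≤ k') :
    DescLe U k' z v :=
  h.imp fun _ hp => ⟨hp.1.trans hk, hp.2⟩

theorem DescLe.KC_le {k : ℕ} {z v : List Bool} (h : DescLe U k z v) : KC U z v ≤ k := by
  obtain ⟨p, hp, hz⟩ := h
  have hmem : p.length ∈ {k | ∃ p : List Bool, p.length = k ∧ z ∈ U p v} := ⟨p, rfl, hz⟩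
  exact (Nat.sInf_le hmem).trans hp

/-- The natural number whose binary expansion is `p` preceded by a leading one. -/
def progIndex (p : List Bool) : ℕ := p.foldr (fun b n => n * 2 + bif b then 1 else 0) 1

theorem progIndex_cons (b : Bool) (p : List Bool) :
    progIndex (b :: p) = progIndex p * 2 + bif b then 1 else 0 := rfl

theorem progIndex_pos (p : List Bool) : 0 < progIndex p := by
  induction p with
  | nil => exact one_pos
  | cons b p ih => rw [progIndex_cons]; omega

theorem progIndex_lt (p : List Bool) : progIndex p < 2 ^ (p.length + 1) := by
  induction p with
  | nil => simp [progIndex]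
  | cons b p ih =>
    rw [progIndex_cons, List.length_cons, pow_succ]
    cases b <;> simp <;> omega

theorem progIndex_injective : Function.Injective progIndex := by
  intro p q h
  induction p generalizing q with
  | nil => cases q with
    | nil => rfl
    | cons c q =>
      have := progIndex_pos q
      rw [progIndex_cons] at h
      simp only [progIndex, List.foldr_nil] at h this
      omega
  | cons b p ih => cases q with
    | nil =>
      have := progIndex_pos p
      rw [progIndex_cons] at h
      simp only [progIndex, List.foldr_nil] at h this
      omega
    | cons c q =>
      rw [progIndex_cons, progIndex_cons] at h
      have hpq : progIndex p = progIndex q := by cases b <;> cases c <;> simp at h <;> omega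
      rw [ih hpq]
      cases b <;> cases c <;> simp at h ⊢ <;> omega

theorem card_le_of_descLe {k : ℕ} {v : List Bool} {s : Finset (List Bool)}
    (h : ∀ z ∈ s, DescLe U k z v) : s.card ≤ 2 ^ (k + 1) := by
  choose! p hp hz using h
  rw [← Finset.card_range (2 ^ (k + 1))]
  refine Finset.card_le_card_of_injOn (fun z => progIndex (p z)) (fun z hz => ?_)
    fun z hzs z' hzs' h => ?_
  · rw [Finset.coe_range, Set.mem_Iio]
    exact (progIndex_lt _).trans_le
      (Nat.pow_le_pow_right two_pos (Nat.succ_le_succ (hp z hz)))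
  · have := hz z hzs
    rw [progIndex_injective h] at this
    exact Part.mem_unique this (hz z' hzs')

theorem card_le_of_descLe_ePair {c s : ℕ} {v : List Bool} {F : Finset (List Bool)}
    (h : ∀ z ∈ F, ∃ x t, z = ePair x t ∧ DescLe U c t v ∧ DescLe U s x (ePair t v)) :
    F.card ≤ 2 ^ (c + s + 2) := by
  choose! x t hz ht hx using h
  have h1 : (F.image t).card ≤ 2 ^ (c + 1) := card_le_of_descLe (v := v) <| by
    simpa using ht
  have h2 : F.card ≤ 2 ^ (s + 1) * (F.image t).card := by
    refine Finset.card_le_mul_card_image F _ fun b _ => ?_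
    have hinj : Set.InjOn x ↑(F.filter fun z => t z = b) := by
      intro z hzF z' hzF' hxx
      rw [Finset.mem_coe, Finset.mem_filter] at hzF hzF'
      rw [hz z hzF.1, hz z' hzF'.1, hxx, hzF.2, hzF'.2]
    rw [← Finset.card_image_of_injOn hinj]
    refine card_le_of_descLe (U := U) (v := ePair b v) ?_
    simp only [Finset.mem_image, Finset.mem_filter]
    rintro _ ⟨z, ⟨hzF, rfl⟩, rfl⟩
    exact hx z hzF
  calc F.card ≤ 2 ^ (s + 1) * 2 ^ (c + 1) := h2.trans (Nat.mul_le_mul_left _ h1)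
    _ = 2 ^ (c + s + 2) := by ring

theorem sigmaOne_mem (hU : Partrec₂ U) :
    SigmaOne fun a : List Bool × List Bool × List Bool => a.2.2 ∈ U a.1 a.2.1 := by
  obtain ⟨c, hc⟩ := Nat.Partrec.Code.exists_code.1 hU
  have h : SigmaOne fun a : List Bool × List Bool × List Bool => ∃ k,
      Nat.Partrec.Code.evaln k c (Encodable.encode (a.1, a.2.1)) = some (Encodable.encode a.2.2) :=
    SigmaOne.ex <| SigmaOne.of_primrecPred <| primrecPred_eq
      (Nat.Partrec.Code.primrec_evaln.comp (f := fun q : (ℕ × Nat.Partrec.Code) × ℕ =>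
        Nat.Partrec.Code.evaln q.1.1 q.1.2 q.2)
        (g := fun a : (List Bool × List Bool × List Bool) × ℕ =>
          ((a.2, c), Encodable.encode (a.1.1, a.1.2.1))) (by fun_prop)) (by fun_prop)
  refine h.of_iff fun a => ?_
  have := Nat.Partrec.Code.evaln_complete (c := c) (n := Encodable.encode (a.1, a.2.1))
    (x := Encodable.encode a.2.2)
  rw [hc] at this
  refine Iff.trans ?_ this
  simp

theorem sigmaOne_descLe (hU : Partrec₂ U) {α : Type} [Primcodable α] {k : α → ℕ}
    {z v : α → List Bool} (hk : Primrec k) (hz : Primrec z) (hv : Primrec v) :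
    SigmaOne fun a => DescLe U (k a) (z a) (v a) :=
  SigmaOne.ex <| (SigmaOne.of_primrecPred <| primrecPred_le (by fun_prop) (by fun_prop)).and <|
    (sigmaOne_mem hU).comp (f := fun q : α × List Bool => (q.2, v q.1, z q.1)) (by fun_prop)

/-- An element of a recursively enumerable set of at most `2 ^ m` strings, given by a parameter of
`O(ℓ)` bits, has complexity at most `m + O(ℓ)`. -/
theorem exists_descLe_of_card_le (hU : IsUniversal U) {ι : Type} [Primcodable ι]
    {R : ι → List Bool → List Bool → Prop}
    (hR : SigmaOne fun a : ι × List Bool × List Bool => R a.1 a.2.1 a.2.2) (A : ℕ) :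
    ∃ c, ∀ ℓ, 1 ≤ ℓ → ∀ w u z m, Encodable.encode w < 2 ^ (A * ℓ) → R w u z →
      (∀ F : Finset (List Bool), (∀ z ∈ F, R w u z) → F.card ≤ 2 ^ m) →
      DescLe U (m + c * ℓ) z u := by
  obtain ⟨g, hg, hR⟩ := hR
  let g' : ((ι × List Bool) × List Bool) × ℕ → Bool :=
    fun q => g ((q.1.1.1, q.1.1.2, q.1.2), q.2)
  have hg' : Primrec g' := by
    change Primrec fun q : ((ι × List Bool) × List Bool) × ℕ => g ((q.1.1.1, q.1.1.2, q.1.2), q.2)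
    fun_prop
  let G : List Bool → List Bool → List Bool → Prop := fun p u z => ∃ (b b' : List Bool) (w : ι)
    (N : ℕ), p = ePair b b' ∧ bitsVal b = Encodable.encode w ∧
      enumList g' (w, u) (N + 1) = z :: enumList g' (w, u) N ∧
      (enumList g' (w, u) N).length = bitsVal b'
  have hG : SigmaOne fun a : List Bool × List Bool × List Bool => G a.1 a.2.1 a.2.2 := by
    refine SigmaOne.ex (SigmaOne.ex (SigmaOne.ex (SigmaOne.ex (SigmaOne.of_primrecPred ?_))))
    refine (primrecPred_eq (by fun_prop) (by fun_prop)).and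
      ((primrecPred_eq (by fun_prop) (by fun_prop)).and
      ((primrecPred_eq (by fun_prop) (by fun_prop)).and
      (primrecPred_eq (by fun_prop) (by fun_prop))))
  obtain ⟨V, hV, hVG⟩ := exists_machine hG
  obtain ⟨c, hc⟩ := hU.2 V hV
  refine ⟨2 * A + 2 + c, fun ℓ hℓ w u z m hw hz hF => ?_⟩
  obtain ⟨b, hbl, hb⟩ := exists_bitsVal_eq hw
  obtain ⟨n, hn⟩ := (hR (w, u, z)).1 hz
  obtain ⟨N, hN⟩ := exists_enumList_succ_eq_cons (g := g') (a := (w, u)) hn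
  have hlen : (enumList g' (w, u) N).length < 2 ^ m := by
    have hspec := enumList_spec (g := g') (w, u) (N + 1)
    have := hF (enumList g' (w, u) (N + 1)).toFinset fun z hz =>
      (hR (w, u, z)).2 (hspec.2 z (List.mem_toFinset.1 hz))
    rw [List.toFinset_card_of_nodup hspec.1, hN, List.length_cons] at this
    omega
  obtain ⟨b', hbl', hb'⟩ := exists_bitsVal_eq hlen
  obtain ⟨q, hq, hql⟩ := hc (ePair b b') u z <| hVG _ _ _ ⟨b, b', w, N, rfl, hb, hN, hb'.symm⟩ <| by
    rintro z' ⟨b₁, b₁', w₁, N₁, hp, hb₁, hN₁, hb₁'⟩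
    obtain ⟨rfl, rfl⟩ := ePair_inj.1 hp
    obtain rfl : w = w₁ := Encodable.encode_injective (hb.symm.trans hb₁)
    exact enumList_cons_unique hN₁ hN (hb₁'.trans hb')
  refine ⟨q, ?_, hq⟩
  have : (ePair b b').length = 2 * (A * ℓ) + 2 + m := by
    rw [ePair, List.length_append, eBits_length, hbl, hbl']
  nlinarith

theorem descLe_KC (hU : IsUniversal U) (z v : List Bool) : DescLe U (KC U z v) z v := by
  obtain ⟨c, hc⟩ := exists_descLe_of_card_le hU (R := fun w _ z => z = w)
    (SigmaOne.of_primrecPred (primrecPred_eq (by fun_prop) (by fun_prop))) 1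
  obtain ⟨p, -, hp⟩ := hc (Encodable.encode z + 1) (by omega) z v z 0
    (Nat.lt_two_pow_self.trans (Nat.pow_lt_pow_right one_lt_two (by omega))) rfl fun F hF => by
      rw [pow_zero, Finset.card_le_one]
      intro a ha b hb
      rw [hF a ha, hF b hb]
  obtain ⟨q, hq, hz⟩ := Nat.sInf_mem (s := {k | ∃ p : List Bool, p.length = k ∧ z ∈ U p v})
    ⟨_, p, rfl, hp⟩
  exact ⟨q, hq.le, hz⟩

end Complexity

section Chain

variable {U : Machine}

theorem add_lt_two_pow {A B ℓ x y : ℕ} (hℓ : 1 ≤ ℓ) (hx : x < 2 ^ (A * ℓ)) (hy : y < 2 ^ (B * ℓ)) :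
    x + y < 2 ^ ((A + B + 1) * ℓ) := by
  have hA : 2 ^ (A * ℓ) ≤ 2 ^ ((A + B) * ℓ) := Nat.pow_le_pow_right two_pos (by nlinarith)
  have hB : 2 ^ (B * ℓ) ≤ 2 ^ ((A + B) * ℓ) := Nat.pow_le_pow_right two_pos (by nlinarith)
  calc x + y < 2 ^ ((A + B) * ℓ + 1) := by rw [pow_succ]; omega
    _ ≤ 2 ^ ((A + B + 1) * ℓ) := Nat.pow_le_pow_right two_pos (by nlinarith)

theorem mul_lt_two_pow (c ℓ : ℕ) : c * ℓ < 2 ^ (c * ℓ) := Nat.lt_two_pow_self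

theorem const_lt_two_pow {ℓ : ℕ} (c : ℕ) (hℓ : 1 ≤ ℓ) : c < 2 ^ (c * ℓ) :=
  Nat.lt_two_pow_self.trans_le (Nat.pow_le_pow_right two_pos (by nlinarith))

theorem encode_prod_lt_two_pow {ι κ : Type} [Encodable ι] [Encodable κ] {A B ℓ : ℕ} {x : ι} {y : κ}
    (hx : Encodable.encode x < 2 ^ (A * ℓ)) (hy : Encodable.encode y < 2 ^ (B * ℓ)) :
    Encodable.encode (x, y) < 2 ^ (2 * (A + B) * ℓ) := by
  rw [Encodable.encode_prod_val]
  refine (Nat.pair_lt_max_add_one_sq _ _).trans_le ?_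
  rw [show 2 * (A + B) * ℓ = (A + B) * ℓ * 2 by ring, pow_mul]
  refine Nat.pow_le_pow_left (Nat.succ_le_of_lt (max_lt (hx.trans_le ?_) (hy.trans_le ?_))) 2 <;>
    exact Nat.pow_le_pow_right two_pos (by nlinarith)

/-- A nonempty set with at most `2 ^ K` elements has size `2 ^ m` up to a factor of two. -/
theorem exists_two_pow_card {Q : List Bool → Prop} {K : ℕ} {z : List Bool} (hz : Q z)
    (hK : ∀ F : Finset (List Bool), (∀ z ∈ F, Q z) → F.card ≤ 2 ^ K) :
    ∃ m ≤ K, (∃ F : Finset (List Bool), 2 ^ m ≤ F.card ∧ ∀ z ∈ F, Q z) ∧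
      ∀ F : Finset (List Bool), (∀ z ∈ F, Q z) → F.card ≤ 2 ^ (m + 1) := by
  classical
  let P : ℕ → Prop := fun m => ∃ F : Finset (List Bool), 2 ^ m ≤ F.card ∧ ∀ z ∈ F, Q z
  have h0 : P 0 := ⟨{z}, by simp, by simpa using hz⟩
  refine ⟨Nat.findGreatest P K, Nat.findGreatest_le K,
    Nat.findGreatest_spec (P := P) (Nat.zero_le K) h0, fun F hF => ?_⟩
  by_contra! h
  have hlt : Nat.findGreatest P K + 1 < K :=
    (Nat.pow_lt_pow_iff_right one_lt_two).1 (h.trans_le (hK F hF))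
  exact Nat.findGreatest_is_greatest (Nat.lt_succ_self _) hlt.le ⟨F, h.le, hF⟩

/-- The hard direction of symmetry of information. -/
theorem exists_KC_add_KC_le (hU : IsUniversal U) (A : ℕ) :
    ∃ c, ∀ ℓ, 1 ≤ ℓ → ∀ a b v k, k < 2 ^ (A * ℓ) → DescLe U k (ePair a b) v →
      KC U a v + KC U b (ePair a v) ≤ k + c * ℓ := by
  obtain ⟨c₁, hc₁⟩ := exists_descLe_of_card_le hU (ι := ℕ × ℕ)
    (R := fun w v a => ∃ s : Finset (List Bool), 2 ^ w.2 ≤ s.card ∧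
      ∀ b ∈ s, DescLe U w.1 (ePair a b) v)
    (SigmaOne.exists_finset (sigmaOne_descLe hU.1 (by fun_prop) (by fun_prop) (by fun_prop))
      (by fun_prop)) (2 * (A + (A + 1 + 1)))
  obtain ⟨c₂, hc₂⟩ := exists_descLe_of_card_le hU (ι := ℕ)
    (R := fun k u b => ∃ a v, u = ePair a v ∧ DescLe U k (ePair a b) v)
    (SigmaOne.ex <| SigmaOne.ex <|
      (SigmaOne.of_primrecPred (primrecPred_eq (by fun_prop) (by fun_prop))).and
      (sigmaOne_descLe hU.1 (by fun_prop) (by fun_prop) (by fun_prop))) A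
  refine ⟨c₁ + c₂ + 2, fun ℓ hℓ a b v k hk hab => ?_⟩
  have hinj : ∀ a, Function.Injective (ePair a) := fun a b b' h => (ePair_inj.1 h).2
  obtain ⟨m, hmk, hm, hm'⟩ := exists_two_pow_card (Q := fun b' => DescLe U k (ePair a b') v)
    (K := k + 1) hab fun F hF => by
      rw [← Finset.card_image_of_injective F (hinj a)]
      exact card_le_of_descLe (by simpa using hF)
  have h₁ : DescLe U ((k + 1 - m) + c₁ * ℓ) a v := by
    refine hc₁ ℓ hℓ (k, m) v a _ (encode_prod_lt_two_pow hk ?_) hm fun F hF => ?_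
    · exact hmk.trans_lt (add_lt_two_pow hℓ hk (const_lt_two_pow 1 hℓ))
    · choose! s hs hs' using hF
      have hdisj : (F : Set (List Bool)).PairwiseDisjoint fun a => (s a).image (ePair a) := by
        intro a _ a' _ hne
        refine Finset.disjoint_left.2 fun z hz hz' => hne ?_
        obtain ⟨b, -, rfl⟩ := Finset.mem_image.1 hz
        obtain ⟨b', -, h⟩ := Finset.mem_image.1 hz'
        exact (ePair_inj.1 h).1.symm
      have hle : F.card * 2 ^ m ≤ 2 ^ (k + 1) := by
        calc F.card * 2 ^ m ≤ ∑ a ∈ F, ((s a).image (ePair a)).card := by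
              rw [← smul_eq_mul]
              refine Finset.card_nsmul_le_sum _ _ _ fun a ha => ?_
              rw [Finset.card_image_of_injective _ (hinj a)]
              exact hs a ha
          _ = (F.biUnion fun a => (s a).image (ePair a)).card := (Finset.card_biUnion hdisj).symm
          _ ≤ 2 ^ (k + 1) := card_le_of_descLe (U := U) (v := v) <| by
              simp only [Finset.mem_biUnion, Finset.mem_image]
              rintro _ ⟨a, ha, b, hb, rfl⟩
              exact hs' a ha b hb
      refine Nat.le_of_mul_le_mul_right (hle.trans_eq ?_) (pow_pos two_pos m)
      rw [← pow_add, Nat.sub_add_cancel hmk]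
  have h₂ : DescLe U ((m + 1) + c₂ * ℓ) b (ePair a v) := by
    refine hc₂ ℓ hℓ k _ b _ hk ⟨a, v, rfl, hab⟩ fun F hF => hm' F fun b' hb' => ?_
    obtain ⟨a', v', h, hd⟩ := hF b' hb'
    obtain ⟨rfl, rfl⟩ := ePair_inj.1 h
    exact hd
  have := h₁.KC_le
  have := h₂.KC_le
  have : (c₁ + c₂ + 2) * ℓ = c₁ * ℓ + c₂ * ℓ + 2 * ℓ := by ring
  omega

/-- The easy direction of symmetry of information. -/
theorem exists_descLe_ePair (hU : IsUniversal U) (A : ℕ) :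
    ∃ c, ∀ ℓ, 1 ≤ ℓ → ∀ x t v k s, k < 2 ^ (A * ℓ) → s < 2 ^ (A * ℓ) → DescLe U k t v →
      DescLe U s x (ePair t v) → DescLe U (k + s + c * ℓ) (ePair x t) v := by
  obtain ⟨c, hc⟩ := exists_descLe_of_card_le hU (ι := ℕ × ℕ)
    (R := fun w v z => ∃ x t, z = ePair x t ∧ DescLe U w.1 t v ∧ DescLe U w.2 x (ePair t v))
    (SigmaOne.ex <| SigmaOne.ex <|
      (SigmaOne.of_primrecPred (primrecPred_eq (by fun_prop) (by fun_prop))).and <|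
      (sigmaOne_descLe hU.1 (by fun_prop) (by fun_prop) (by fun_prop)).and
      (sigmaOne_descLe hU.1 (by fun_prop) (by fun_prop) (by fun_prop))) (2 * (A + A))
  refine ⟨c + 2, fun ℓ hℓ x t v k s hk hs ht hx => ?_⟩
  refine (hc ℓ hℓ (k, s) v _ (k + s + 2) (encode_prod_lt_two_pow hk hs)
    ⟨x, t, rfl, ht, hx⟩ fun F hF => card_le_of_descLe_ePair hF).mono ?_
  have : (c + 2) * ℓ = c * ℓ + 2 * ℓ := by ring
  omega

/-- If `M` holds for about `2 ^ m` strings of complexity at most `C(x)`, including `x`, then `t`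
has about `C(t) + m - C(x)` bits given `x`. -/
theorem exists_KC_add_KC_le_card (hU : IsUniversal U) {M : List Bool → List Bool → Prop}
    (hM : SigmaOne fun a : List Bool × List Bool => M a.1 a.2) (A : ℕ) :
    ∃ c, ∀ ℓ, 1 ≤ ℓ → ∀ x t v, KC U x v < 2 ^ (A * ℓ) → KC U t v < 2 ^ (A * ℓ) → M x t →
      ∃ m ≤ KC U x v + 1,
        (∃ F : Finset (List Bool), 2 ^ m ≤ F.card ∧ ∀ x' ∈ F, M x' t ∧ DescLe U (KC U x v) x' v) ∧
        KC U x v + KC U t (ePair x v) ≤ KC U t v + m + c * ℓ := by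
  obtain ⟨c₁, hc₁⟩ := exists_descLe_of_card_le hU (ι := ℕ)
    (R := fun p u x => ∃ t v, u = ePair t v ∧ M x t ∧ DescLe U p x v)
    (SigmaOne.ex <| SigmaOne.ex <|
      (SigmaOne.of_primrecPred (primrecPred_eq (by fun_prop) (by fun_prop))).and <|
      (hM.comp (f := fun a : ((ℕ × List Bool × List Bool) × List Bool) × List Bool =>
        (a.1.1.2.2, a.1.2)) (by fun_prop)).and
      (sigmaOne_descLe hU.1 (by fun_prop) (by fun_prop) (by fun_prop))) A
  obtain ⟨c₂, hc₂⟩ := exists_descLe_ePair hU ((A + 2 + 1) + c₁ + 1)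
  obtain ⟨c₃, hc₃⟩ := exists_KC_add_KC_le hU
    ((A + ((A + 2 + 1) + c₁ + 1) + 1) + c₂ + 1)
  refine ⟨c₁ + c₂ + c₃ + 1, fun ℓ hℓ x t v hx ht hxt => ?_⟩
  obtain ⟨m, hmk, hm, hm'⟩ := exists_two_pow_card
    (Q := fun x' => M x' t ∧ DescLe U (KC U x v) x' v) (K := KC U x v + 1)
    ⟨hxt, descLe_KC hU x v⟩ fun F hF => card_le_of_descLe fun z hz => (hF z hz).2
  refine ⟨m, hmk, hm, ?_⟩
  have h₁ : DescLe U (m + 1 + c₁ * ℓ) x (ePair t v) := by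
    refine hc₁ ℓ hℓ _ _ x _ hx ⟨t, v, rfl, hxt, descLe_KC hU x v⟩ fun F hF => hm' F fun x' hx' => ?_
    obtain ⟨t', v', h, hd⟩ := hF x' hx'
    obtain ⟨rfl, rfl⟩ := ePair_inj.1 h
    exact hd
  have hs : m + 1 + c₁ * ℓ < 2 ^ (((A + 2 + 1) + c₁ + 1) * ℓ) :=
    add_lt_two_pow hℓ ((Nat.succ_le_succ hmk).trans_lt
      (add_lt_two_pow hℓ hx (const_lt_two_pow 2 hℓ))) (mul_lt_two_pow c₁ ℓ)
  have ht' : KC U t v < 2 ^ (((A + 2 + 1) + c₁ + 1) * ℓ) :=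
    ht.trans_le (Nat.pow_le_pow_right two_pos (by nlinarith))
  have h₂ := hc₂ ℓ hℓ x t v _ _ ht' hs (descLe_KC hU t v) h₁
  have h₃ := hc₃ ℓ hℓ x t v _
    (add_lt_two_pow hℓ (add_lt_two_pow hℓ ht hs) (mul_lt_two_pow c₂ ℓ)) h₂
  have : (c₁ + c₂ + c₃ + 1) * ℓ = c₁ * ℓ + c₂ * ℓ + c₃ * ℓ + ℓ := by ring
  omega

/-- If `G v x` defines `f` as a function of `t`, then splitting `t` as `f` followed by `t` given `f`
costs `O(ℓ)` bits, conditionally on `x` and `v`. -/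
theorem exists_KC_add_KC_le_of_functional (hU : IsUniversal U)
    {G : List Bool → List Bool → List Bool → List Bool → Prop}
    (hG : SigmaOne fun a : List Bool × List Bool × List Bool × List Bool =>
      G a.1 a.2.1 a.2.2.1 a.2.2.2) (A : ℕ) :
    ∃ c, ∀ ℓ, 1 ≤ ℓ → ∀ v x t f, KC U t (ePair x v) < 2 ^ (A * ℓ) → G v x t f →
      (∀ t' f₁ f₂, G v x t' f₁ → G v x t' f₂ → f₁ = f₂) →
      KC U f (ePair x v) + KC U t (ePair x (ePair f v)) ≤ KC U t (ePair x v) + c * ℓ := by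
  obtain ⟨c₁, hc₁⟩ := exists_descLe_of_card_le hU (ι := ℕ)
    (R := fun k u z => ∃ x v f t, u = ePair x v ∧ z = ePair f t ∧ G v x t f ∧ DescLe U k t u)
    (SigmaOne.ex <| SigmaOne.ex <| SigmaOne.ex <| SigmaOne.ex <|
      (SigmaOne.of_primrecPred (primrecPred_eq (by fun_prop) (by fun_prop))).and <|
      (SigmaOne.of_primrecPred (primrecPred_eq (by fun_prop) (by fun_prop))).and <|
      (hG.comp (f := fun a : ((((ℕ × List Bool × List Bool) × List Bool) × List Bool) × List Bool) ×
        List Bool => (a.1.1.2, a.1.1.1.2, a.2, a.1.2)) (by fun_prop)).and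
      (sigmaOne_descLe hU.1 (by fun_prop) (by fun_prop) (by fun_prop))) A
  obtain ⟨c₂, hc₂⟩ := exists_KC_add_KC_le hU ((A + 1 + 1) + c₁ + 1)
  obtain ⟨c₃, hc₃⟩ := exists_descLe_of_card_le hU (ι := ℕ)
    (R := fun k u t => ∃ x f v, u = ePair x (ePair f v) ∧ DescLe U k t (ePair f (ePair x v)))
    (SigmaOne.ex <| SigmaOne.ex <| SigmaOne.ex <|
      (SigmaOne.of_primrecPred (primrecPred_eq (by fun_prop) (by fun_prop))).and
      (sigmaOne_descLe hU.1 (by fun_prop) (by fun_prop) (by fun_prop)))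
    (((A + 1 + 1) + c₁ + 1) + c₂ + 1)
  refine ⟨c₁ + c₂ + c₃ + 2, fun ℓ hℓ v x t f ht hf hfun => ?_⟩
  have h₁ : DescLe U (KC U t (ePair x v) + 1 + c₁ * ℓ) (ePair f t) (ePair x v) := by
    refine hc₁ ℓ hℓ _ _ _ _ ht ⟨x, v, f, t, rfl, rfl, hf, descLe_KC hU _ _⟩ fun F hF => ?_
    choose! x' v' f' t' hu hz hG' hd using hF
    have hxv : ∀ z ∈ F, x' z = x ∧ v' z = v := fun z hz => by
      obtain ⟨h, h'⟩ := ePair_inj.1 (hu z hz)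
      exact ⟨h.symm, h'.symm⟩
    have hinj : Set.InjOn t' F := by
      intro z hzF z' hzF' htt
      have h₁ := hG' z hzF
      have h₂ := hG' z' hzF'
      rw [(hxv z hzF).1, (hxv z hzF).2, htt] at h₁
      rw [(hxv z' hzF').1, (hxv z' hzF').2] at h₂
      rw [hz z hzF, hz z' hzF', htt, hfun _ _ _ h₁ h₂]
    rw [← Finset.card_image_of_injOn hinj]
    exact card_le_of_descLe (U := U) (v := ePair x v) (Finset.forall_mem_image.2 hd)
  have hk : KC U t (ePair x v) + 1 + c₁ * ℓ < 2 ^ (((A + 1 + 1) + c₁ + 1) * ℓ) :=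
    add_lt_two_pow hℓ (add_lt_two_pow hℓ ht (const_lt_two_pow 1 hℓ)) (mul_lt_two_pow c₁ ℓ)
  have h₂ := hc₂ ℓ hℓ f t (ePair x v) _ hk h₁
  have h₃ : DescLe U (KC U t (ePair f (ePair x v)) + 1 + c₃ * ℓ) t (ePair x (ePair f v)) := by
    refine hc₃ ℓ hℓ _ _ _ _ ?_ ⟨x, f, v, rfl, descLe_KC hU _ _⟩ fun F hF => ?_
    · exact ((Nat.le_add_left _ _).trans h₂).trans_lt
        (add_lt_two_pow hℓ hk (mul_lt_two_pow c₂ ℓ))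
    · refine card_le_of_descLe (U := U) (v := ePair f (ePair x v)) fun z hz => ?_
      obtain ⟨x', f', v', h, hd⟩ := hF z hz
      obtain ⟨rfl, h'⟩ := ePair_inj.1 h
      obtain ⟨rfl, rfl⟩ := ePair_inj.1 h'
      exact hd
  have := h₃.KC_le
  have : (c₁ + c₂ + c₃ + 2) * ℓ = c₁ * ℓ + c₂ * ℓ + c₃ * ℓ + 2 * ℓ := by ring
  omega

end Chain

section Protocols

theorem encEProt_eq {n₁ n₂ : ℕ} (P : EProtocol n₁ n₂) : encEProt P =
    ePair (ePair (eList (P.rects.map encRect))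
      (eList ((allBV n₁).flatMap fun x => (allBV n₂).map fun y => encRect (P.trans x y))))
    (ePair (eList ((allBV n₁).flatMap fun x => P.rects.map fun R => P.gA x R))
      (eList ((allBV n₂).flatMap fun y => P.rects.map fun R => P.gB y R))) := rfl

/-- A rectangle as a pair of lists. -/
def rectEquiv : Rect ≃ List (List Bool) × List (List Bool) where
  toFun R := (R.rows, R.cols)
  invFun q := ⟨q.1, q.2⟩
  left_inv _ := rfl
  right_inv _ := rfl

instance : Primcodable Rect := Primcodable.ofEquiv _ rectEquiv

section

variable {α : Type} [Primcodable α] {f : α → Rect}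

@[fun_prop]
theorem primrec_rows (hf : Primrec f) : Primrec fun a => (f a).rows :=
  Primrec.fst.comp ((Primrec.of_equiv (e := rectEquiv)).comp hf)

@[fun_prop]
theorem primrec_cols (hf : Primrec f) : Primrec fun a => (f a).cols :=
  Primrec.snd.comp ((Primrec.of_equiv (e := rectEquiv)).comp hf)

@[fun_prop]
theorem primrec_encRect (hf : Primrec f) : Primrec fun a => encRect (f a) := by
  unfold encRect
  fun_prop

end

/-- The number of rectangles of a list containing a given cell. -/
def cellCount (L : List Rect) (x y : List Bool) : ℕ :=
  L.countP fun R => decide (x ∈ R.rows ∧ y ∈ R.cols)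

@[fun_prop]
theorem primrec_cellCount {α : Type} [Primcodable α] {L : α → List Rect} {x y : α → List Bool}
    (hL : Primrec L) (hx : Primrec x) (hy : Primrec y) :
    Primrec fun a => cellCount (L a) (x a) (y a) := by
  have hR : PrimrecRel fun (R : Rect) (q : List Bool × List Bool) =>
      q.1 ∈ R.rows ∧ q.2 ∈ R.cols :=
    (primrecPred_mem (f := fun a : Rect × List Bool × List Bool => a.2.1) (by fun_prop)
      (by fun_prop)).and (primrecPred_mem (by fun_prop) (by fun_prop))
  have h := primrec_length (hR.listFilter.comp hL (hx.pair hy))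
  refine h.of_eq fun a => ?_
  rw [cellCount, List.countP_eq_length_filter]

/-- `t` encodes a rectangle having `x` among its rows. -/
def HasRow (x t : List Bool) : Prop := ∃ R, t = encRect R ∧ x ∈ R.rows

/-- `t` encodes a rectangle having `y` among its columns. -/
def HasCol (y t : List Bool) : Prop := ∃ R, t = encRect R ∧ y ∈ R.cols

theorem hasRow_encRect {x : List Bool} {R : Rect} : HasRow x (encRect R) ↔ x ∈ R.rows :=
  ⟨fun ⟨_, h, hx⟩ => encRect_injective h ▸ hx, fun h => ⟨R, rfl, h⟩⟩

theorem hasCol_encRect {y : List Bool} {R : Rect} : HasCol y (encRect R) ↔ y ∈ R.cols :=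
  ⟨fun ⟨_, h, hy⟩ => encRect_injective h ▸ hy, fun h => ⟨R, rfl, h⟩⟩

theorem sigmaOne_hasRow : SigmaOne fun a : List Bool × List Bool => HasRow a.1 a.2 :=
  SigmaOne.ex <| SigmaOne.of_primrecPred <|
    (primrecPred_eq (by fun_prop) (by fun_prop)).and (primrecPred_mem (by fun_prop) (by fun_prop))

theorem sigmaOne_hasCol : SigmaOne fun a : List Bool × List Bool => HasCol a.1 a.2 :=
  SigmaOne.ex <| SigmaOne.of_primrecPred <|
    (primrecPred_eq (by fun_prop) (by fun_prop)).and (primrecPred_mem (by fun_prop) (by fun_prop))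

/-- `t` encodes a rectangle of thickness at most `2 ^ r` of the protocol encoded by `v`. -/
def IsThin (r : ℕ) (v t : List Bool) : Prop :=
  ∃ (L : List Rect) (w w' : List Bool) (R : Rect),
    v = ePair (ePair (eList (L.map encRect)) w) w' ∧ R ∈ L ∧ t = encRect R ∧
      ∀ x ∈ R.rows, ∀ y ∈ R.cols, cellCount L x y ≤ 2 ^ r

theorem sigmaOne_isThin : SigmaOne fun a : ℕ × List Bool × List Bool => IsThin a.1 a.2.1 a.2.2 := by
  have henc : Primrec encRect := primrec_encRect Primrec.id
  refine SigmaOne.ex <| SigmaOne.ex <| SigmaOne.ex <| SigmaOne.ex <| SigmaOne.of_primrecPred ?_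
  refine (primrecPred_eq (by fun_prop) (by fun_prop)).and <|
    (primrecPred_mem (by fun_prop) (by fun_prop)).and <|
    (primrecPred_eq (by fun_prop) (by fun_prop)).and <|
    primrecPred_forall_mem (by fun_prop) <| primrecPred_forall_mem (by fun_prop) <|
    primrecPred_le (by fun_prop) (by fun_prop)

theorem isThin_encEProt {n₁ n₂ : ℕ} {P : EProtocol n₁ n₂} {r : ℕ} {t : List Bool} :
    IsThin r (encEProt P) t ↔ ∃ R ∈ P.rects, t = encRect R ∧
      ∀ x ∈ R.rows, ∀ y ∈ R.cols, cellCount P.rects x y ≤ 2 ^ r := by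
  constructor
  · rintro ⟨L, w, w', R, h, hR⟩
    rw [encEProt_eq, ePair_inj, ePair_inj] at h
    obtain rfl := encRect_injective.list_map (eList_injective h.1.1)
    exact ⟨R, hR⟩
  · rintro ⟨R, hR⟩
    exact ⟨_, _, _, R, encEProt_eq P, hR⟩

theorem cellCount_le_rectThick {n₁ n₂ : ℕ} (P : Protocol n₁ n₂) {R : Rect} {x y : List Bool}
    (hx : x ∈ R.rows) (hy : y ∈ R.cols) : cellCount P.rects x y ≤ rectThick P R := by
  have hmem : cellThick P x y ∈ R.rows.flatMap fun x => R.cols.map fun y => cellThick P x y :=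
    List.mem_flatMap.2 ⟨x, hx, List.mem_map.2 ⟨y, hy, rfl⟩⟩
  exact List.le_max_of_le hmem le_rfl

theorem cellCount_pos {L : List Rect} {R : Rect} {x y : List Bool} (hR : R ∈ L) (hx : x ∈ R.rows)
    (hy : y ∈ R.cols) : 0 < cellCount L x y :=
  List.countP_pos_iff.2 ⟨R, hR, by simp [hx, hy]⟩

theorem card_le_cellCount {L : List Rect} {x y : List Bool} {F : Finset (List Bool)}
    (hF : ∀ t ∈ F, ∃ R ∈ L, t = encRect R ∧ x ∈ R.rows ∧ y ∈ R.cols) :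
    F.card ≤ cellCount L x y := by
  rw [cellCount, List.countP_eq_length_filter, ← List.length_map (f := encRect)]
  refine le_trans (Finset.card_le_card fun t ht => ?_) (List.toFinset_card_le _)
  obtain ⟨R, hR, rfl, hxy⟩ := hF t ht
  exact List.mem_toFinset.2 (List.mem_map.2 ⟨R, List.mem_filter.2 ⟨hR, by simpa using hxy⟩, rfl⟩)

/-- Double counting for a family of products in which every cell is covered at most `N` times. -/
theorem card_mul_le_mul_card {α β : Type} [DecidableEq β] {F : Finset α} {S T : α → Finset β}
    {X Y : Finset β} {a b N : ℕ} (hS : ∀ t ∈ F, a ≤ (S t).card) (hT : ∀ t ∈ F, b ≤ (T t).card)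
    (hX : ∀ t ∈ F, S t ⊆ X) (hY : ∀ t ∈ F, T t ⊆ Y)
    (hN : ∀ x y, (F.filter fun t => x ∈ S t ∧ y ∈ T t).card ≤ N) :
    F.card * (a * b) ≤ X.card * Y.card * N := by
  calc F.card * (a * b)
      ≤ ∑ t ∈ F, ((X ×ˢ Y).bipartiteAbove (fun t z => z.1 ∈ S t ∧ z.2 ∈ T t) t).card := by
        rw [← smul_eq_mul]
        refine Finset.card_nsmul_le_sum _ _ _ fun t ht => ?_
        refine (Nat.mul_le_mul (hS t ht) (hT t ht)).trans ?_
        rw [← Finset.card_product]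
        refine Finset.card_le_card fun z hz => ?_
        rw [Finset.mem_product] at hz
        exact Finset.mem_filter.2 ⟨Finset.mem_product.2 ⟨hX t ht hz.1, hY t ht hz.2⟩, hz⟩
    _ = ∑ z ∈ X ×ˢ Y, (F.bipartiteBelow (fun t z => z.1 ∈ S t ∧ z.2 ∈ T t) z).card :=
        Finset.sum_card_bipartiteAbove_eq_sum_card_bipartiteBelow _
    _ ≤ (X ×ˢ Y).card • N := Finset.sum_le_card_nsmul _ _ _ fun z _ => hN z.1 z.2
    _ = X.card * Y.card * N := by rw [smul_eq_mul, Finset.card_product]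

variable {U : Machine}

theorem exists_KC_le_length (hU : IsUniversal U) :
    ∃ c, ∀ ℓ, 1 ≤ ℓ → ∀ x v, x.length < 2 ^ ℓ → KC U x v ≤ x.length + c * ℓ := by
  obtain ⟨c, hc⟩ := exists_descLe_of_card_le hU (ι := ℕ) (R := fun n _ z => z.length = n)
    (SigmaOne.of_primrecPred (primrecPred_eq (by fun_prop) (by fun_prop))) 1
  refine ⟨c, fun ℓ hℓ x v hx => (hc ℓ hℓ _ v x _ (by simpa using hx) rfl fun F hF => ?_).KC_le⟩
  have h : F ⊆ (allBV x.length).toFinset := fun z hz =>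
    List.mem_toFinset.2 (List.mem_of_getElem? (getElem?_allBV (hF z hz)))
  exact (Finset.card_le_card h).trans ((List.toFinset_card_le _).trans (allBV_length _).le)

theorem exists_KC_trans_le (hU : IsUniversal U) :
    ∃ c, ∀ ℓ, 1 ≤ ℓ → ∀ n₁ n₂, ∀ P : EProtocol n₁ n₂, ∀ x y, x.length = n₁ → y.length = n₂ →
      KC U (encRect (P.trans x y)) (encEProt P) ≤ n₁ + n₂ + c * ℓ := by
  obtain ⟨c, hc⟩ := exists_descLe_of_card_le hU (ι := ℕ)
    (R := fun _ v t => ∃ (T : List (List Bool)) (w w' : List Bool),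
      v = ePair (ePair w (eList T)) w' ∧ t ∈ T)
    (SigmaOne.ex <| SigmaOne.ex <| SigmaOne.ex <| SigmaOne.of_primrecPred <|
      (primrecPred_eq (by fun_prop) (by fun_prop)).and
      (primrecPred_mem (by fun_prop) (by fun_prop))) 1
  refine ⟨c, fun ℓ hℓ n₁ n₂ P x y hx hy => (hc ℓ hℓ 0 _ _ _ (by simp)
    ⟨_, _, _, encEProt_eq P, ?_⟩ fun F hF => ?_).KC_le⟩
  · exact List.mem_flatMap.2 ⟨x, List.mem_of_getElem? (getElem?_allBV hx),
      List.mem_map.2 ⟨y, List.mem_of_getElem? (getElem?_allBV hy), rfl⟩⟩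
  · have h : F ⊆ ((allBV n₁).flatMap fun x =>
        (allBV n₂).map fun y => encRect (P.trans x y)).toFinset := by
      intro t ht
      obtain ⟨T, w, w', h, ht⟩ := hF t ht
      rw [encEProt_eq, ePair_inj, ePair_inj] at h
      exact List.mem_toFinset.2 (eList_injective h.1.2 ▸ ht)
    refine (Finset.card_le_card h).trans ((List.toFinset_card_le _).trans ?_)
    simp [List.length_flatMap, allBV_length, pow_add]

/-- A thin rectangle with many simple rows and many simple columns is simple: there are few such
rectangles. -/
theorem exists_KC_le_of_isThin (hU : IsUniversal U) (A : ℕ) :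
    ∃ c, ∀ ℓ, 1 ≤ ℓ → ∀ n₁ n₂, ∀ P : EProtocol n₁ n₂, ∀ t p q s s' r,
      p < 2 ^ (A * ℓ) → q < 2 ^ (A * ℓ) → s < 2 ^ (A * ℓ) → s' < 2 ^ (A * ℓ) → r < 2 ^ (A * ℓ) →
      IsThin r (encEProt P) t →
      (∃ F : Finset (List Bool), 2 ^ s ≤ F.card ∧
        ∀ x ∈ F, HasRow x t ∧ DescLe U p x (encEProt P)) →
      (∃ F : Finset (List Bool), 2 ^ s' ≤ F.card ∧
        ∀ y ∈ F, HasCol y t ∧ DescLe U q y (encEProt P)) →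
      s ≤ p + 1 → s' ≤ q + 1 →
      KC U t (encEProt P) + s + s' ≤ p + q + r + c * ℓ := by
  obtain ⟨c, hc⟩ := exists_descLe_of_card_le hU (ι := (ℕ × ℕ) × (ℕ × ℕ) × ℕ)
    (R := fun w v t => IsThin w.2.2 v t ∧
      (∃ F : Finset (List Bool), 2 ^ w.2.1.1 ≤ F.card ∧ ∀ x ∈ F, HasRow x t ∧ DescLe U w.1.1 x v) ∧
      ∃ F : Finset (List Bool), 2 ^ w.2.1.2 ≤ F.card ∧ ∀ y ∈ F, HasCol y t ∧ DescLe U w.1.2 y v)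
    ((sigmaOne_isThin.comp (f := fun a : ((ℕ × ℕ) × (ℕ × ℕ) × ℕ) × List Bool × List Bool =>
        (a.1.2.2, a.2.1, a.2.2)) (by fun_prop)).and <|
      (SigmaOne.exists_finset ((sigmaOne_hasRow.comp (f := fun a : (((ℕ × ℕ) × (ℕ × ℕ) × ℕ) ×
        List Bool × List Bool) × List Bool => (a.2, a.1.2.2)) (by fun_prop)).and
        (sigmaOne_descLe hU.1 (by fun_prop) (by fun_prop) (by fun_prop))) (by fun_prop)).and
      (SigmaOne.exists_finset ((sigmaOne_hasCol.comp (f := fun a : (((ℕ × ℕ) × (ℕ × ℕ) × ℕ) ×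
        List Bool × List Bool) × List Bool => (a.2, a.1.2.2)) (by fun_prop)).and
        (sigmaOne_descLe hU.1 (by fun_prop) (by fun_prop) (by fun_prop))) (by fun_prop)))
    (2 * (2 * (A + A) + 2 * (2 * (A + A) + A)))
  refine ⟨c + 2, fun ℓ hℓ n₁ n₂ P t p q s s' r hp hq hs hs' hr hthin hrow hcol hsp hsq => ?_⟩
  have h := hc ℓ hℓ ((p, q), (s, s'), r) (encEProt P) t (r + (p + 1 - s) + (q + 1 - s'))
    (encode_prod_lt_two_pow (encode_prod_lt_two_pow hp hq)
      (encode_prod_lt_two_pow (encode_prod_lt_two_pow hs hs') hr)) ⟨hthin, hrow, hcol⟩ <| by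
    intro F hF
    choose! hthin hrows hcols using hF
    choose! S hS hSrow hSdesc using hrows
    choose! T hT hTcol hTdesc using hcols
    have hX : (F.biUnion S).card ≤ 2 ^ (p + 1) :=
      card_le_of_descLe (U := U) (v := encEProt P) fun x hx => by
        obtain ⟨t, ht, hx⟩ := Finset.mem_biUnion.1 hx
        exact hSdesc t ht x hx
    have hY : (F.biUnion T).card ≤ 2 ^ (q + 1) :=
      card_le_of_descLe (U := U) (v := encEProt P) fun y hy => by
        obtain ⟨t, ht, hy⟩ := Finset.mem_biUnion.1 hy
        exact hTdesc t ht y hy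
    have hcount := card_mul_le_mul_card (N := 2 ^ r) hS hT
      (fun t ht => Finset.subset_biUnion_of_mem S ht)
      (fun t ht => Finset.subset_biUnion_of_mem T ht) fun x y => by
        rcases Finset.eq_empty_or_nonempty (F.filter fun t => x ∈ S t ∧ y ∈ T t) with h | ⟨t, ht⟩
        · simp [h]
        have key : ∀ t ∈ F.filter fun t => x ∈ S t ∧ y ∈ T t, ∃ R ∈ P.rects, t = encRect R ∧
            x ∈ R.rows ∧ y ∈ R.cols ∧ cellCount P.rects x y ≤ 2 ^ r := by
          intro t ht
          obtain ⟨ht, hx, hy⟩ := Finset.mem_filter.1 ht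
          obtain ⟨R, hR, rfl, hle⟩ := isThin_encEProt.1 (hthin t ht)
          have hx := hasRow_encRect.1 (hSrow _ ht x hx)
          have hy := hasCol_encRect.1 (hTcol _ ht y hy)
          exact ⟨R, hR, rfl, hx, hy, hle x hx y hy⟩
        obtain ⟨-, -, -, -, -, hle⟩ := key t ht
        refine (card_le_cellCount fun t ht => ?_).trans hle
        obtain ⟨R, hR, h, hx, hy, -⟩ := key t ht
        exact ⟨R, hR, h, hx, hy⟩
    refine Nat.le_of_mul_le_mul_right (c := 2 ^ s * 2 ^ s') ?_ (by positivity)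
    refine hcount.trans ((Nat.mul_le_mul_right _ (Nat.mul_le_mul hX hY)).trans_eq ?_)
    simp only [← pow_add]
    congr 1
    omega
  have := h.KC_le
  have : (c + 2) * ℓ = c * ℓ + 2 * ℓ := by ring
  omega

/-- The complexities of the transcript given either input add up to at most the complexity of the
transcript plus the logarithm of its thickness, up to `O(ℓ)`; both are bounded by `2 ^ O(ℓ)`. -/
theorem exists_KC_add_KC_le_KC_add (hU : IsUniversal U) :
    ∃ A c, ∀ ℓ, 1 ≤ ℓ → ∀ n₁ n₂, n₁ < 2 ^ ℓ → n₂ < 2 ^ ℓ → ∀ P : EProtocol n₁ n₂, ∀ x y,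
      x.length = n₁ → y.length = n₂ →
      KC U (encRect (P.trans x y)) (ePair x (encEProt P)) < 2 ^ (A * ℓ) ∧
      KC U (encRect (P.trans x y)) (ePair y (encEProt P)) < 2 ^ (A * ℓ) ∧
      ∀ r, rectThick P.toProtocol (P.trans x y) ≤ 2 ^ r →
        KC U (encRect (P.trans x y)) (ePair x (encEProt P)) +
          KC U (encRect (P.trans x y)) (ePair y (encEProt P)) ≤
        KC U (encRect (P.trans x y)) (encEProt P) + r + c * ℓ := by
  obtain ⟨c₁, hc₁⟩ := exists_KC_le_length hU
  obtain ⟨c₂, hc₂⟩ := exists_KC_trans_le hU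
  let A := (1 + 1 + 1) + (c₁ + c₂) + 1
  obtain ⟨c₃, hc₃⟩ := exists_KC_add_KC_le_card hU sigmaOne_hasRow A
  obtain ⟨c₄, hc₄⟩ := exists_KC_add_KC_le_card hU sigmaOne_hasCol A
  let B := (A + A + 1) + (c₃ + c₄ + 2) + 1
  obtain ⟨c₅, hc₅⟩ := exists_KC_le_of_isThin hU B
  refine ⟨A + (c₃ + c₄ + 1) + 1, c₃ + c₄ + c₅, fun ℓ hℓ n₁ n₂ hn₁ hn₂ P x y hx hy => ?_⟩
  set t := encRect (P.trans x y) with ht_def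
  set v := encEProt P with hv_def
  have hsum : n₁ + n₂ + (c₁ + c₂) * ℓ < 2 ^ (A * ℓ) :=
    add_lt_two_pow hℓ (add_lt_two_pow hℓ (by rwa [one_mul]) (by rwa [one_mul]))
      (mul_lt_two_pow _ _)
  rw [add_mul] at hsum
  have hxv := hc₁ ℓ hℓ x v (by rwa [hx])
  have hyv := hc₁ ℓ hℓ y v (by rwa [hy])
  have htv : KC U t v ≤ n₁ + n₂ + c₂ * ℓ := hc₂ ℓ hℓ n₁ n₂ P x y hx hy
  rw [hx] at hxv
  rw [hy] at hyv
  have hxv : KC U x v < 2 ^ (A * ℓ) := by omega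
  have hyv : KC U y v < 2 ^ (A * ℓ) := by omega
  have htv : KC U t v < 2 ^ (A * ℓ) := by omega
  obtain ⟨s, hs, hsF, hsle⟩ := hc₃ ℓ hℓ x t v hxv htv (hasRow_encRect.2 (P.trans_row x y hx hy))
  obtain ⟨s', hs', hsF', hsle'⟩ := hc₄ ℓ hℓ y t v hyv htv (hasCol_encRect.2 (P.trans_col x y hx hy))
  have hbound := add_lt_two_pow hℓ htv (mul_lt_two_pow (c₃ + c₄ + 1) ℓ)
  simp only [add_mul _ _ ℓ] at hbound hsum ⊢
  refine ⟨by omega, by omega, fun r hr => ?_⟩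
  by_cases hrs : r < KC U t (ePair x v) + KC U t (ePair y v)
  · have hB : KC U x v + KC U y v + (c₃ + c₄ + 2) * ℓ < 2 ^ (B * ℓ) :=
      add_lt_two_pow hℓ (add_lt_two_pow hℓ hxv hyv) (mul_lt_two_pow _ _)
    have hB' : KC U t v + KC U t v + (c₃ + c₄ + 2) * ℓ < 2 ^ (B * ℓ) :=
      add_lt_two_pow hℓ (add_lt_two_pow hℓ htv htv) (mul_lt_two_pow _ _)
    simp only [add_mul _ _ ℓ] at hB hB'
    have hthin : IsThin r v t := isThin_encEProt.2 ⟨_, P.trans_mem x y hx hy, rfl,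
      fun x hx y hy => (cellCount_le_rectThick P.toProtocol hx hy).trans hr⟩
    have : KC U t v + s + s' ≤ KC U x v + KC U y v + r + c₅ * ℓ :=
      hc₅ ℓ hℓ n₁ n₂ P t (KC U x v) (KC U y v) s s' r (by omega) (by omega) (by omega)
      (by omega) (by omega) hthin hsF hsF' hs hs'
    omega
  · omega

/-- `T` lists the values of an output function, first by its input and then by its rectangle in the
list `L`, and has the entry `f` at `x` and `t`. -/
def IsEntry (L T : List (List Bool)) (x t f : List Bool) : Prop :=
  ∃ i, L[i]? = some t ∧ T[bitsVal x * L.length + i]? = some f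

theorem sigmaOne_isEntry {α : Type} [Primcodable α] {L T : α → List (List Bool)}
    {x t f : α → List Bool} (hL : Primrec L) (hT : Primrec T) (hx : Primrec x) (ht : Primrec t)
    (hf : Primrec f) : SigmaOne fun a => IsEntry (L a) (T a) (x a) (t a) (f a) :=
  SigmaOne.ex <| SigmaOne.of_primrecPred <|
    (primrecPred_eq (by fun_prop) (by fun_prop)).and (primrecPred_eq (by fun_prop) (by fun_prop))

theorem isEntry_iff {n : ℕ} {l : List Rect} {g : List Bool → Rect → List Bool} {x t f : List Bool}
    (hx : x.length = n) :
    IsEntry (l.map encRect) ((allBV n).flatMap fun x => l.map fun R => g x R) x t f ↔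
      ∃ R ∈ l, t = encRect R ∧ f = g x R := by
  have key : ∀ {i R}, l[i]? = some R → ((allBV n).flatMap fun x => l.map fun R => g x R)[
      bitsVal x * (l.map encRect).length + i]? = some (g x R) := by
    intro i R h
    exact getElem?_flatMap_of_length (by simp) (getElem?_allBV hx) (by simp [h])
  constructor
  · rintro ⟨i, hi, hf⟩
    rw [List.getElem?_map, Option.map_eq_some_iff] at hi
    obtain ⟨R, hR, rfl⟩ := hi
    rw [key hR] at hf
    exact ⟨R, List.mem_of_getElem? hR, rfl, (Option.some.inj hf).symm⟩
  · rintro ⟨R, hR, rfl, rfl⟩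
    obtain ⟨i, hi⟩ := List.getElem?_of_mem hR
    exact ⟨i, by simp [hi], key hi⟩

theorem exists_KC_gA_add_le (hU : IsUniversal U) (A : ℕ) :
    ∃ c, ∀ ℓ, 1 ≤ ℓ → ∀ n₁ n₂, ∀ P : EProtocol n₁ n₂, ∀ x R, x.length = n₁ → R ∈ P.rects →
      KC U (encRect R) (ePair x (encEProt P)) < 2 ^ (A * ℓ) →
      KC U (P.gA x R) (ePair x (encEProt P)) +
          KC U (encRect R) (ePair x (ePair (P.gA x R) (encEProt P))) ≤
        KC U (encRect R) (ePair x (encEProt P)) + c * ℓ := by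
  obtain ⟨c, hc⟩ := exists_KC_add_KC_le_of_functional hU
    (G := fun v x t f => ∃ (L T : List (List Bool)) (w w' : List Bool),
      v = ePair (ePair (eList L) w) (ePair (eList T) w') ∧ IsEntry L T x t f)
    (SigmaOne.ex <| SigmaOne.ex <| SigmaOne.ex <| SigmaOne.ex <|
      (SigmaOne.of_primrecPred (primrecPred_eq (by fun_prop) (by fun_prop))).and <|
      sigmaOne_isEntry (by fun_prop) (by fun_prop) (by fun_prop) (by fun_prop) (by fun_prop)) A
  refine ⟨c, fun ℓ hℓ n₁ n₂ P x R hx hR ht => hc ℓ hℓ _ x _ _ ht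
    ⟨_, _, _, _, encEProt_eq P, (isEntry_iff hx).2 ⟨R, hR, rfl, rfl⟩⟩ ?_⟩
  have key : ∀ t f, (∃ (L T : List (List Bool)) (w w' : List Bool),
      encEProt P = ePair (ePair (eList L) w) (ePair (eList T) w') ∧ IsEntry L T x t f) →
      ∃ R ∈ P.rects, t = encRect R ∧ f = P.gA x R := by
    rintro t f ⟨L, T, w, w', h, hf⟩
    rw [encEProt_eq, ePair_inj, ePair_inj, ePair_inj] at h
    obtain rfl := eList_injective h.1.1
    obtain rfl := eList_injective h.2.1
    exact (isEntry_iff hx).1 hf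
  intro t f₁ f₂ h₁ h₂
  obtain ⟨R₁, -, rfl, rfl⟩ := key t f₁ h₁
  obtain ⟨R₂, -, h, rfl⟩ := key _ f₂ h₂
  rw [encRect_injective h]

theorem exists_KC_gB_add_le (hU : IsUniversal U) (A : ℕ) :
    ∃ c, ∀ ℓ, 1 ≤ ℓ → ∀ n₁ n₂, ∀ P : EProtocol n₁ n₂, ∀ y R, y.length = n₂ → R ∈ P.rects →
      KC U (encRect R) (ePair y (encEProt P)) < 2 ^ (A * ℓ) →
      KC U (P.gB y R) (ePair y (encEProt P)) +
          KC U (encRect R) (ePair y (ePair (P.gB y R) (encEProt P))) ≤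
        KC U (encRect R) (ePair y (encEProt P)) + c * ℓ := by
  obtain ⟨c, hc⟩ := exists_KC_add_KC_le_of_functional hU
    (G := fun v x t f => ∃ (L T : List (List Bool)) (w w' : List Bool),
      v = ePair (ePair (eList L) w) (ePair w' (eList T)) ∧ IsEntry L T x t f)
    (SigmaOne.ex <| SigmaOne.ex <| SigmaOne.ex <| SigmaOne.ex <|
      (SigmaOne.of_primrecPred (primrecPred_eq (by fun_prop) (by fun_prop))).and <|
      sigmaOne_isEntry (by fun_prop) (by fun_prop) (by fun_prop) (by fun_prop) (by fun_prop)) A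
  refine ⟨c, fun ℓ hℓ n₁ n₂ P y R hy hR ht => hc ℓ hℓ _ y _ _ ht
    ⟨_, _, _, _, encEProt_eq P, (isEntry_iff hy).2 ⟨R, hR, rfl, rfl⟩⟩ ?_⟩
  have key : ∀ t f, (∃ (L T : List (List Bool)) (w w' : List Bool),
      encEProt P = ePair (ePair (eList L) w) (ePair w' (eList T)) ∧ IsEntry L T y t f) →
      ∃ R ∈ P.rects, t = encRect R ∧ f = P.gB y R := by
    rintro t f ⟨L, T, w, w', h, hf⟩
    rw [encEProt_eq, ePair_inj, ePair_inj, ePair_inj] at h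
    obtain rfl := eList_injective h.1.1
    obtain rfl := eList_injective h.2.2
    exact (isEntry_iff hy).1 hf
  intro t f₁ f₂ h₁ h₂
  obtain ⟨R₁, -, rfl, rfl⟩ := key t f₁ h₁
  obtain ⟨R₂, -, h, rfl⟩ := key _ f₂ h₂
  rw [encRect_injective h]

/-- The transcript bound for a single input pair on which both parties output the same value. -/
theorem exists_KC_bound (hU : IsUniversal U) :
    ∃ c, ∀ ℓ, 1 ≤ ℓ → ∀ n₁ n₂, n₁ < 2 ^ ℓ → n₂ < 2 ^ ℓ → ∀ P : EProtocol n₁ n₂, ∀ x y z,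
      x.length = n₁ → y.length = n₂ → P.gA x (P.trans x y) = z → P.gB y (P.trans x y) = z →
      ∀ r, rectThick P.toProtocol (P.trans x y) ≤ 2 ^ r →
        KC U z (ePair x (encEProt P)) + KC U z (ePair y (encEProt P)) +
          KC U (encRect (P.trans x y)) (ePair x (ePair z (encEProt P))) +
          KC U (encRect (P.trans x y)) (ePair y (ePair z (encEProt P))) ≤
        KC U (encRect (P.trans x y)) (encEProt P) + r + c * ℓ := by
  obtain ⟨A, c₁, hc₁⟩ := exists_KC_add_KC_le_KC_add hU
  obtain ⟨c₂, hc₂⟩ := exists_KC_gA_add_le hU A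
  obtain ⟨c₃, hc₃⟩ := exists_KC_gB_add_le hU A
  refine ⟨c₁ + c₂ + c₃, fun ℓ hℓ n₁ n₂ hn₁ hn₂ P x y z hx hy hA hB r hr => ?_⟩
  obtain ⟨hxt, hyt, h⟩ := hc₁ ℓ hℓ n₁ n₂ hn₁ hn₂ P x y hx hy
  have h₁ := h r hr
  have h₂ := hc₂ ℓ hℓ n₁ n₂ P x _ hx (P.trans_mem x y hx hy) hxt
  have h₃ := hc₃ ℓ hℓ n₁ n₂ P y _ hy (P.trans_mem x y hx hy) hyt
  rw [hA] at h₂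
  rw [hB] at h₃
  simp only [add_mul _ _ ℓ]
  omega

theorem natSize_le_logb (n : ℕ) : (Nat.size (n + 2) : ℝ) ≤ Real.logb 2 n + 3 := by
  rcases Nat.eq_zero_or_pos n with rfl | hn
  · have : Nat.size (0 + 2) = 2 := by decide
    rw [this]
    norm_num
  have h : 2 ^ Nat.size (n + 2) ≤ n * 2 ^ 3 := by
    obtain ⟨k, hk⟩ : ∃ k, Nat.size (n + 2) = k + 1 :=
      Nat.exists_eq_succ_of_ne_zero (Nat.size_pos.2 (by omega)).ne'
    have : 2 ^ k ≤ n + 2 := Nat.lt_size.1 (by omega)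
    rw [hk, pow_succ]
    omega
  have hn' : (0 : ℝ) < n := Nat.cast_pos.2 hn
  have h' : ((2 : ℝ) ^ (Nat.size (n + 2) : ℝ)) ≤ 2 ^ (Real.logb 2 n + 3) := by
    rw [Real.rpow_natCast, Real.rpow_add two_pos, Real.rpow_logb two_pos (by norm_num) hn']
    exact_mod_cast h
  exact (Real.rpow_le_rpow_left_iff one_lt_two).1 h'

theorem natClog_le_logb {m : ℕ} (hm : 0 < m) : (Nat.clog 2 m : ℝ) ≤ Real.logb 2 m + 1 := by
  rw [← Real.natCeil_logb_natCast]
  exact (Nat.ceil_lt_add_one (Real.logb_nonneg one_lt_two (Nat.one_le_cast.2 hm))).le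

theorem finite_setOf_length_eq (n₁ n₂ : ℕ) :
    {p : List Bool × List Bool | p.1.length = n₁ ∧ p.2.length = n₂}.Finite :=
  (List.finite_length_eq Bool n₁).prod (List.finite_length_eq Bool n₂)

end Protocols

end TranscriptBound

/-- For protocols computing a computable function `f` with error `ε`, the transcript
lower bound holds for at least a `(1 - d'·ε)` fraction of all inputs. -/
theorem stmt8 (U : Machine) (hU : IsUniversal U)
    (f : List Bool → List Bool → List Bool) (hf : Computable₂ f) :
    ∃ d d' : ℝ, ∀ ε : ℝ, 0 ≤ ε → ε ≤ 1 → ∀ n₁ n₂ : ℕ, ∀ P : EProtocol n₁ n₂,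
      ((Nat.card {p : List Bool × List Bool //
          p.1.length = n₁ ∧ p.2.length = n₂ ∧
          P.gA p.1 (P.trans p.1 p.2) = f p.1 p.2 ∧
          P.gB p.2 (P.trans p.1 p.2) = f p.1 p.2} : ℝ) ≥ (1 - ε) * 2 ^ (n₁ + n₂)) →
      (Nat.card {p : List Bool × List Bool //
          p.1.length = n₁ ∧ p.2.length = n₂ ∧
          (KC U (encRect (P.trans p.1 p.2)) (encEProt P) : ℝ) ≥
            (KC U (f p.1 p.2) (ePair p.1 (encEProt P)) : ℝ)
            + KC U (f p.1 p.2) (ePair p.2 (encEProt P))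
            + KC U (encRect (P.trans p.1 p.2)) (ePair p.1 (ePair (f p.1 p.2) (encEProt P)))
            + KC U (encRect (P.trans p.1 p.2)) (ePair p.2 (ePair (f p.1 p.2) (encEProt P)))
            - Real.logb 2 (rectThick P.toProtocol (P.trans p.1 p.2))
            - d * Real.logb 2 (max n₁ n₂) - d} : ℝ)
        ≥ (1 - d' * ε) * 2 ^ (n₁ + n₂) := by
  obtain ⟨c, hc⟩ := TranscriptBound.exists_KC_bound hU
  refine ⟨3 * c + 1, 1, fun ε _ _ n₁ n₂ P hP => ?_⟩
  rw [one_mul]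
  refine ge_trans (Nat.cast_le.2 (Nat.card_mono
    ((TranscriptBound.finite_setOf_length_eq n₁ n₂).subset fun p hp => ⟨hp.1, hp.2.1⟩) ?_)) hP
  rintro ⟨x, y⟩ ⟨hx, hy, hA, hB⟩
  refine ⟨hx, hy, ?_⟩
  dsimp only at hx hy hA hB ⊢
  have hmax : max n₁ n₂ + 2 < 2 ^ Nat.size (max n₁ n₂ + 2) := Nat.lt_size_self _
  have hthick : 0 < rectThick P.toProtocol (P.trans x y) :=
    (TranscriptBound.cellCount_pos (P.trans_mem x y hx hy) (P.trans_row x y hx hy)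
      (P.trans_col x y hx hy)).trans_le (TranscriptBound.cellCount_le_rectThick P.toProtocol
        (P.trans_row x y hx hy) (P.trans_col x y hx hy))
  have hbound := hc (Nat.size (max n₁ n₂ + 2)) (Nat.size_pos.2 (by omega)) n₁ n₂ (by omega)
    (by omega) P x y (f x y) hx hy hA hB _
    (Nat.le_pow_clog one_lt_two (rectThick P.toProtocol (P.trans x y)))
  have hbound := (Nat.cast_le (α := ℝ)).2 hbound
  have hclog := TranscriptBound.natClog_le_logb hthick
  have hsize := TranscriptBound.natSize_le_logb (max n₁ n₂)
  have hlog : 0 ≤ Real.logb 2 (max n₁ n₂ : ℕ) :=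
    div_nonneg (Real.log_natCast_nonneg _) (Real.log_nonneg one_le_two)
  push_cast at hbound hsize hlog
  have hc₀ : (0 : ℝ) ≤ c := Nat.cast_nonneg c
  nlinarith [mul_le_mul_of_nonneg_left hsize hc₀, mul_nonneg hc₀ hlog]
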